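/- Let n ≥ 1, let Ω ⊆ ℝⁿ be a nonempty open connected set, and let u : Ω → ℝ be a smooth solution of the Lagrangian shrinker potential equation ∑_{i=1}^n arctan λ_i(x) = (1/2) x·∇u(x) − u(x) on Ω, where λ_1(x), …, λ_n(x) are the eigenvalues of the Hessian D²u(x). Assume that for every boundary point z ∈ ∂Ω, ‖∇u(x)‖ tends to +∞ as x → z within Ω. Then Ω = ℝⁿ and there exist a symmetric real n×n matrix A and a constant c ∈ ℝ such that u(x) = (1/2) xᵀAx + c for all x ∈ ℝⁿ; in particular the Lagrangian shrinker (x, ∇u(x)) is a plane. -/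

import Mathlib

/-- The `i`-th partial derivative of `u : ℝⁿ → ℝ` at `x`. -/
noncomputable def pd {n : ℕ} (u : EuclideanSpace ℝ (Fin n) → ℝ) (i : Fin n)
    (x : EuclideanSpace ℝ (Fin n)) : ℝ :=
  fderiv ℝ u x (EuclideanSpace.single i 1)

/-- The second partial derivative `∂²_{ij} u` at `x`. -/
noncomputable def pd2 {n : ℕ} (u : EuclideanSpace ℝ (Fin n) → ℝ) (i j : Fin n)
    (x : EuclideanSpace ℝ (Fin n)) : ℝ :=
  pd (fun y => pd u j y) i x

/-- The Hessian matrix `D²u(x)`. -/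
noncomputable def hessM {n : ℕ} (u : EuclideanSpace ℝ (Fin n) → ℝ)
    (x : EuclideanSpace ℝ (Fin n)) : Matrix (Fin n) (Fin n) ℝ :=
  Matrix.of fun i j => pd2 u i j x

open scoped ContDiff

section PartialDerivatives

variable {n : ℕ} {Ω : Set (EuclideanSpace ℝ (Fin n))}
  {f g : EuclideanSpace ℝ (Fin n) → ℝ} {x : EuclideanSpace ℝ (Fin n)}

lemma ContDiffOn.contDiffOn_pd (hf : ContDiffOn ℝ ∞ f Ω) (hΩ : IsOpen Ω) (i : Fin n) :
    ContDiffOn ℝ ∞ (pd f i) Ω :=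
  (hf.fderiv_of_isOpen hΩ (by simp)).clm_apply contDiffOn_const

lemma ContDiffOn.differentiableAt_of_isOpen (hf : ContDiffOn ℝ ∞ f Ω) (hΩ : IsOpen Ω)
    (hx : x ∈ Ω) : DifferentiableAt ℝ f x :=
  (hf.contDiffAt (hΩ.mem_nhds hx)).differentiableAt (by simp)

lemma Filter.EventuallyEq.pd_eq (h : f =ᶠ[nhds x] g) (i : Fin n) : pd f i x = pd g i x := by
  rw [pd, pd, h.fderiv_eq]

lemma Set.EqOn.pd_eq (h : Set.EqOn f g Ω) (hΩ : IsOpen Ω) (i : Fin n) :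
    Set.EqOn (pd f i) (pd g i) Ω := fun _ hx =>
  (h.eventuallyEq_of_mem (hΩ.mem_nhds hx)).pd_eq i

lemma pd_add (hf : DifferentiableAt ℝ f x) (hg : DifferentiableAt ℝ g x) (i : Fin n) :
    pd (fun y => f y + g y) i x = pd f i x + pd g i x := by
  simp [pd, fderiv_fun_add hf hg]

lemma pd_sub (hf : DifferentiableAt ℝ f x) (hg : DifferentiableAt ℝ g x) (i : Fin n) :
    pd (fun y => f y - g y) i x = pd f i x - pd g i x := by
  simp [pd, fderiv_fun_sub hf hg]

lemma pd_mul (hf : DifferentiableAt ℝ f x) (hg : DifferentiableAt ℝ g x) (i : Fin n) :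
    pd (fun y => f y * g y) i x = f x * pd g i x + pd f i x * g x := by
  simp [pd, fderiv_fun_mul hf hg, mul_comm]

lemma pd_const_mul (hf : DifferentiableAt ℝ f x) (c : ℝ) (i : Fin n) :
    pd (fun y => c * f y) i x = c * pd f i x := by
  simp [pd, fderiv_const_mul hf]

lemma pd_const (c : ℝ) (i : Fin n) : pd (fun _ => c) i x = 0 := by
  simp [pd]

lemma pd_sum {ι : Type*} {s : Finset ι} {F : ι → EuclideanSpace ℝ (Fin n) → ℝ}
    (hF : ∀ a ∈ s, DifferentiableAt ℝ (F a) x) (i : Fin n) :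
    pd (fun y => ∑ a ∈ s, F a y) i x = ∑ a ∈ s, pd (F a) i x := by
  simp [pd, fderiv_fun_sum hF]

lemma contDiff_coord (i : Fin n) :
    ContDiff ℝ ∞ (fun y : EuclideanSpace ℝ (Fin n) => y i) :=
  (EuclideanSpace.proj i : EuclideanSpace ℝ (Fin n) →L[ℝ] ℝ).contDiff

lemma pd_coord (i j : Fin n) :
    pd (fun y : EuclideanSpace ℝ (Fin n) => y j) i x = if j = i then 1 else 0 := by
  have h : HasFDerivAt (fun y : EuclideanSpace ℝ (Fin n) => y j)
      (EuclideanSpace.proj j : EuclideanSpace ℝ (Fin n) →L[ℝ] ℝ) x :=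
    (EuclideanSpace.proj j : EuclideanSpace ℝ (Fin n) →L[ℝ] ℝ).hasFDerivAt
  simp [pd, h.fderiv]

lemma fderiv_apply_eq_sum_pd (v : EuclideanSpace ℝ (Fin n)) :
    fderiv ℝ f x v = ∑ i, v i * pd f i x := by
  conv_lhs => rw [← (EuclideanSpace.basisFun (Fin n) ℝ).sum_repr v]
  simp [map_sum, pd]

lemma hasDerivAt_comp_line {v : EuclideanSpace ℝ (Fin n)} {t : ℝ}
    (hf : DifferentiableAt ℝ f (x + t • v)) :
    HasDerivAt (fun s : ℝ => f (x + s • v)) (∑ i, v i * pd f i (x + t • v)) t := by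
  rw [← fderiv_apply_eq_sum_pd]
  have h : HasDerivAt (fun s : ℝ => x + s • v) v t := by
    simpa using ((hasDerivAt_id t).smul_const v).const_add x
  exact hf.hasFDerivAt.comp_hasDerivAt t h

lemma ContDiffOn.pd2_comm (hf : ContDiffOn ℝ ∞ f Ω) (hΩ : IsOpen Ω) (hx : x ∈ Ω)
    (i j : Fin n) : pd2 f i j x = pd2 f j i x := by
  have hfx : ContDiffAt ℝ ∞ f x := hf.contDiffAt (hΩ.mem_nhds hx)
  have hd : DifferentiableAt ℝ (fderiv ℝ f) x :=
    ((hf.fderiv_of_isOpen hΩ (m := ∞) (by simp)).contDiffAt (hΩ.mem_nhds hx)).differentiableAt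
      (by simp)
  have key : ∀ i j, pd2 f i j x
      = fderiv ℝ (fderiv ℝ f) x (EuclideanSpace.single i 1) (EuclideanSpace.single j 1) := by
    intro i j
    have : pd2 f i j x = fderiv ℝ (fun y => fderiv ℝ f y (EuclideanSpace.single j 1)) x
      (EuclideanSpace.single i 1) := rfl
    rw [this, fderiv_clm_apply hd (by fun_prop)]
    simp
  rw [key, key]
  refine hfx.isSymmSndFDerivAt ?_ _ _
  rw [minSmoothness_of_isRCLikeNormedField]
  exact WithTop.coe_le_coe.2 (le_top : (2 : ℕ∞) ≤ ⊤)

lemma IsLocalMax.pd_eq_zero (h : IsLocalMax f x) (i : Fin n) : pd f i x = 0 := by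
  simp [pd, h.fderiv_eq_zero]

/-- The Hessian is negative semidefinite at a local maximum. -/
lemma IsLocalMax.sum_pd2_nonpos (h : IsLocalMax f x) (hf : ContDiffOn ℝ ∞ f Ω)
    (hΩ : IsOpen Ω) (hx : x ∈ Ω) (v : EuclideanSpace ℝ (Fin n)) :
    ∑ i, ∑ j, v i * v j * pd2 f i j x ≤ 0 := by
  by_contra! hpos
  set q : ℝ → ℝ := fun s => f (x + s • v)
  have hcont : Continuous fun s : ℝ => x + s • v := by fun_prop
  have hmem : ∀ᶠ s in nhds (0 : ℝ), x + s • v ∈ Ω :=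
    hcont.continuousAt.eventually (by simpa using hΩ.mem_nhds hx)
  have hq : ∀ᶠ s in nhds (0 : ℝ), deriv q s = ∑ j, v j * pd f j (x + s • v) := by
    filter_upwards [hmem] with s hs
    exact (hasDerivAt_comp_line (hf.differentiableAt_of_isOpen hΩ hs)).deriv
  have hq2 : deriv (deriv q) 0 = ∑ i, ∑ j, v i * v j * pd2 f i j x := by
    rw [Filter.EventuallyEq.deriv_eq hq]
    have : HasDerivAt (fun s : ℝ => ∑ j, v j * pd f j (x + s • v))
        (∑ j, v j * ∑ i, v i * pd (pd f j) i (x + (0 : ℝ) • v)) 0 := by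
      refine HasDerivAt.fun_sum fun j _ => HasDerivAt.const_mul _ (hasDerivAt_comp_line ?_)
      simpa using (hf.contDiffOn_pd hΩ j).differentiableAt_of_isOpen hΩ hx
    rw [this.deriv, Finset.sum_congr rfl fun j _ => Finset.mul_sum _ _ _, Finset.sum_comm]
    refine Finset.sum_congr rfl fun i _ => Finset.sum_congr rfl fun j _ => ?_
    rw [zero_smul, add_zero, pd2]
    ring
  have hmax : IsLocalMax q 0 := by
    have : ∀ᶠ y in nhds (x + (0 : ℝ) • v), f y ≤ f x := by
      rw [zero_smul, add_zero]
      exact h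
    have := hcont.continuousAt.eventually this
    simpa [IsLocalMax, IsMaxFilter, q] using this
  have hmin : IsLocalMin q 0 :=
    isLocalMin_of_deriv_deriv_pos (hq2 ▸ hpos) hmax.deriv_eq_zero
      (hasDerivAt_comp_line (by simpa using hf.differentiableAt_of_isOpen hΩ hx)).continuousAt
  have hconst : q =ᶠ[nhds 0] fun _ => q 0 := by
    filter_upwards [hmax, hmin] with s h1 h2 using le_antisymm h1 h2
  have h1 : deriv q =ᶠ[nhds 0] fun _ => 0 := by
    filter_upwards [hconst.eventuallyEq_nhds] with s hs
    rw [hs.deriv_eq, deriv_const]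
  have h2 : deriv (deriv q) 0 = 0 := by rw [h1.deriv_eq, deriv_const]
  rw [hq2] at h2
  exact hpos.ne' h2

end PartialDerivatives

section LagrangianAngle

open Matrix

variable {n : ℕ}

/-- Jacobi's formula. -/
lemma Matrix.hasDerivAt_det {B : ℝ → Matrix (Fin n) (Fin n) ℂ} {B' : Matrix (Fin n) (Fin n) ℂ}
    {t : ℝ} (h : ∀ i j, HasDerivAt (fun s => B s i j) (B' i j) t) :
    HasDerivAt (fun s => (B s).det) (((B t).adjugate * B').trace) t := by
  have key : HasDerivAt (fun s => ∑ σ : Equiv.Perm (Fin n), ((σ.sign : ℤ) : ℂ) * ∏ j, B s (σ j) j)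
      (∑ σ : Equiv.Perm (Fin n), ((σ.sign : ℤ) : ℂ) *
        ∑ i, (∏ j ∈ Finset.univ.erase i, B t (σ j) j) • B' (σ i) i) t :=
    HasDerivAt.fun_sum fun σ _ => (HasDerivAt.fun_finsetProd fun j _ => h (σ j) j).const_mul _
  simp only [det_apply']
  convert key using 1
  have hcol : ∀ i, ((B t).adjugate * B') i i = ((B t).updateCol i (fun j => B' j i)).det := by
    intro i
    rw [← cramer_apply, cramer_eq_adjugate_mulVec]
    rfl
  simp only [trace, diag_apply, hcol, det_apply', Finset.mul_sum]
  rw [Finset.sum_comm]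
  refine Finset.sum_congr rfl fun σ _ => Finset.sum_congr rfl fun i _ => ?_
  rw [← Finset.mul_prod_erase Finset.univ _ (Finset.mem_univ i), updateCol_self, smul_eq_mul,
    mul_comm (B' _ _)]
  congr 2
  refine Finset.prod_congr rfl fun j hj => ?_
  rw [updateCol_ne (Finset.ne_of_mem_erase hj)]

lemma Complex.one_add_I_mul_ofReal_eq (a : ℝ) :
    1 + I * (a : ℂ) = (Real.sqrt (1 + a ^ 2) : ℂ) * exp (Real.arctan a * I) := by
  have h : (Real.sqrt (1 + a ^ 2) : ℂ) ≠ 0 :=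
    Complex.ofReal_ne_zero.2 (Real.sqrt_pos.2 (by positivity)).ne'
  rw [exp_mul_I, ← ofReal_cos, ← ofReal_sin, Real.cos_arctan, Real.sin_arctan]
  push_cast
  field_simp

lemma Matrix.IsHermitian.det_one_add_I_smul {A : Matrix (Fin n) (Fin n) ℝ} (hA : A.IsHermitian) :
    (1 + Complex.I • A.map Complex.ofReal).det
      = ((∏ i, Real.sqrt (1 + hA.eigenvalues i ^ 2) : ℝ) : ℂ)
        * Complex.exp ((∑ i, Real.arctan (hA.eigenvalues i) : ℝ) * Complex.I) := by
  have h1 : (A.map Complex.ofReal).charpoly.eval Complex.I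
      = ∏ i, (Complex.I - (hA.eigenvalues i : ℂ)) := by
    have : A.map Complex.ofReal = A.map Complex.ofRealHom := rfl
    rw [this, charpoly_map, hA.charpoly_eq, Polynomial.eval_map, Polynomial.eval₂_finsetProd]
    simp
  have h2 : 1 + Complex.I • A.map Complex.ofReal
      = (-Complex.I) • (scalar (Fin n) Complex.I - A.map Complex.ofReal) := by
    ext i j
    by_cases hij : i = j <;> simp [hij, mul_sub]
  rw [h2, det_smul, ← eval_charpoly, h1, Fintype.card, ← Finset.prod_const,
    ← Finset.prod_mul_distrib]
  push_cast
  rw [Finset.sum_mul, Complex.exp_sum, ← Finset.prod_mul_distrib]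
  refine Finset.prod_congr rfl fun i _ => ?_
  rw [← Complex.ofReal_arctan, ← Complex.one_add_I_mul_ofReal_eq, mul_sub, neg_mul, Complex.I_mul_I]
  ring

lemma Matrix.IsHermitian.posDef_one_add_mul_self {A : Matrix (Fin n) (Fin n) ℝ}
    (hA : A.IsHermitian) : (1 + A * A).PosDef := by
  have := posSemidef_conjTranspose_mul_self A
  rw [hA.eq] at this
  exact PosDef.one.add_posSemidef this

/-- The first variation of the Lagrangian angle. -/
lemma trace_inv_one_add_sq_mul_eq {A : ℝ → Matrix (Fin n) (Fin n) ℝ}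
    {A' : Matrix (Fin n) (Fin n) ℝ} {θ : ℝ → ℝ} {θ' t : ℝ}
    (hA : ∀ᶠ s in nhds t, (A s).IsHermitian)
    (hA' : ∀ i j, HasDerivAt (fun s => A s i j) (A' i j) t) (hθ' : HasDerivAt θ θ' t)
    (hθ : ∀ᶠ s in nhds t, ∀ h : (A s).IsHermitian, ∑ i, Real.arctan (h.eigenvalues i) = θ s) :
    ((1 + A t * A t)⁻¹ * A').trace = θ' := by
  set B : ℝ → Matrix (Fin n) (Fin n) ℂ := fun s => 1 + Complex.I • (A s).map Complex.ofReal
  set C : Matrix (Fin n) (Fin n) ℝ := (1 + A t * A t)⁻¹ with hC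
  have hAt := hA.self_of_nhds
  have hdet : (B t).det = _ := hAt.det_one_add_I_smul
  have hr : 0 < ∏ i, Real.sqrt (1 + hAt.eigenvalues i ^ 2) :=
    Finset.prod_pos fun i _ => Real.sqrt_pos.2 (by positivity)
  rw [hθ.self_of_nhds hAt] at hdet
  set r := ∏ i, Real.sqrt (1 + hAt.eigenvalues i ^ 2)
  have hCmul : (1 + A t * A t) * C = 1 :=
    mul_nonsing_inv _ hAt.posDef_one_add_mul_self.det_pos.ne'.isUnit
  have hinv : B t * ((1 - Complex.I • (A t).map Complex.ofReal) * C.map Complex.ofReal) = 1 := by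
    have h1 : B t * (1 - Complex.I • (A t).map Complex.ofReal)
        = (1 + A t * A t).map Complex.ofRealHom := by
      rw [Matrix.map_add _ (map_add _), Matrix.map_mul, Matrix.map_one _ (map_zero _) (map_one _)]
      simp only [B, add_mul, mul_sub, one_mul, mul_one, smul_mul_smul_comm, Complex.I_mul_I,
        neg_one_smul]
      have : (A t).map Complex.ofReal = (A t).map Complex.ofRealHom := rfl
      rw [this]
      abel
    rw [← Matrix.mul_assoc, h1]
    have : C.map Complex.ofReal = C.map Complex.ofRealHom := rfl
    rw [this, ← Matrix.map_mul, hCmul, Matrix.map_one _ (map_zero _) (map_one _)]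
  have hadj : (B t).adjugate
      = (B t).det • ((1 - Complex.I • (A t).map Complex.ofReal) * C.map Complex.ofReal) := by
    have := congrArg ((B t).adjugate * ·) hinv
    simpa only [← Matrix.mul_assoc (B t).adjugate, adjugate_mul, smul_mul_assoc, Matrix.one_mul,
      Matrix.mul_one] using this.symm
  have hB : HasDerivAt (fun s => (B s).det)
      (((B t).adjugate * (Complex.I • A'.map Complex.ofReal)).trace) t := by
    refine hasDerivAt_det fun i j => ?_
    simpa [B] using ((hA' i j).ofReal_comp.const_mul Complex.I).const_add ((1 : Matrix _ _ ℂ) i j)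
  have hE : HasDerivAt (fun s => Complex.exp (-(θ s * Complex.I)))
      (Complex.exp (-(θ t * Complex.I)) * -(θ' * Complex.I)) t :=
    ((hθ'.ofReal_comp.mul_const Complex.I).neg).cexp
  have htr : ((B t).adjugate * (Complex.I • A'.map Complex.ofReal)).trace
      = (B t).det * (((A t * C * A').trace : ℝ) + Complex.I * ((C * A').trace : ℝ)) := by
    have h1 : (((A t * C * A').trace : ℝ) : ℂ)
        = ((A t).map Complex.ofReal * C.map Complex.ofReal * A'.map Complex.ofReal).trace := by
      simp [trace, mul_apply]
    have h2 : (((C * A').trace : ℝ) : ℂ)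
        = (C.map Complex.ofReal * A'.map Complex.ofReal).trace := by
      simp [trace, mul_apply]
    rw [h1, h2, hadj]
    simp only [smul_mul_assoc, mul_smul_comm, sub_mul, Matrix.one_mul, trace_smul, trace_sub,
      smul_eq_mul, mul_sub]
    ring_nf
    rw [Complex.I_sq]
    ring
  have hF := hB.mul hE
  rw [htr, hdet] at hF
  have hreal : (fun s => (B s).det * Complex.exp (-(θ s * Complex.I)))
      =ᶠ[nhds t] fun s => ((((B s).det * Complex.exp (-(θ s * Complex.I))).re : ℝ) : ℂ) := by
    filter_upwards [hA, hθ] with s h1 h2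
    rw [show (B s).det = _ from h1.det_one_add_I_smul, h2 h1, mul_assoc, ← Complex.exp_add,
      add_neg_cancel, Complex.exp_zero, mul_one, Complex.ofReal_re]
  have him : HasDerivAt (fun s => ((B s).det * Complex.exp (-(θ s * Complex.I))).im) 0 t := by
    refine (hasDerivAt_const t (0 : ℝ)).congr_of_eventuallyEq ?_
    filter_upwards [hreal] with s hs
    rw [hs, Complex.ofReal_im]
  have him' := Complex.imCLM.hasFDerivAt.comp_hasDerivAt t hF
  have h0 := him.unique him'
  have hexp : Complex.exp (θ t * Complex.I) * Complex.exp (-(θ t * Complex.I)) = 1 := by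
    rw [← Complex.exp_add, add_neg_cancel, Complex.exp_zero]
  have hval : (r : ℂ) * Complex.exp (θ t * Complex.I)
        * (((A t * C * A').trace : ℝ) + Complex.I * ((C * A').trace : ℝ))
        * Complex.exp (-(θ t * Complex.I))
      + (r : ℂ) * Complex.exp (θ t * Complex.I)
        * (Complex.exp (-(θ t * Complex.I)) * -(θ' * Complex.I))
      = (r : ℂ) * (((A t * C * A').trace : ℝ) + Complex.I * (((C * A').trace - θ' : ℝ))) := by
    push_cast
    linear_combination (r : ℂ) * (((A t * C * A').trace : ℝ)
      + Complex.I * ((C * A').trace : ℝ) - θ' * Complex.I) * hexp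
  rw [hval] at h0
  simp at h0
  rcases h0 with h0 | h0
  · exact absurd h0 hr.ne'
  · linarith

end LagrangianAngle

section MaximumPrinciple

open Matrix Metric

variable {n : ℕ} {Ω : Set (EuclideanSpace ℝ (Fin n))}
  {f g : EuclideanSpace ℝ (Fin n) → ℝ} {x : EuclideanSpace ℝ (Fin n)}
  {G : EuclideanSpace ℝ (Fin n) → Matrix (Fin n) (Fin n) ℝ}

/-- The operator `f ↦ Gⁱʲ ∂ᵢⱼ f - (1/2) x · ∇f`. -/
noncomputable def shrinkerOp (G : EuclideanSpace ℝ (Fin n) → Matrix (Fin n) (Fin n) ℝ)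
    (f : EuclideanSpace ℝ (Fin n) → ℝ) (x : EuclideanSpace ℝ (Fin n)) : ℝ :=
  ∑ i, ∑ j, G x i j * pd2 f i j x - (1 / 2) * ∑ i, x i * pd f i x

lemma shrinkerOp_add_const_mul (hf : ContDiffOn ℝ ∞ f Ω) (hg : ContDiffOn ℝ ∞ g Ω)
    (hΩ : IsOpen Ω) (hx : x ∈ Ω) (c : ℝ) :
    shrinkerOp G (fun y => f y + c * g y) x = shrinkerOp G f x + c * shrinkerOp G g x := by
  have h1 : ∀ y ∈ Ω, ∀ j, pd (fun y => f y + c * g y) j y = pd f j y + c * pd g j y := by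
    intro y hy j
    have hgd := hg.differentiableAt_of_isOpen hΩ hy
    rw [pd_add (hf.differentiableAt_of_isOpen hΩ hy) (hgd.const_mul c), pd_const_mul hgd]
  have h2 : ∀ i j, pd2 (fun y => f y + c * g y) i j x = pd2 f i j x + c * pd2 g i j x := by
    intro i j
    have hfd := (hf.contDiffOn_pd hΩ j).differentiableAt_of_isOpen hΩ hx
    have hgd := (hg.contDiffOn_pd hΩ j).differentiableAt_of_isOpen hΩ hx
    have : pd2 (fun y => f y + c * g y) i j x = pd (fun y => pd f j y + c * pd g j y) i x :=
      Set.EqOn.pd_eq (fun y hy => h1 y hy j) hΩ i hx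
    rw [this, pd_add hfd (hgd.const_mul c), pd_const_mul hgd]
    rfl
  simp only [shrinkerOp, h1 x hx, h2, mul_add, Finset.sum_add_distrib, mul_left_comm _ c,
    ← Finset.mul_sum]
  ring

open scoped MatrixOrder Matrix.Norms.L2Operator in
lemma IsLocalMax.shrinkerOp_nonpos (h : IsLocalMax f x) (hf : ContDiffOn ℝ ∞ f Ω)
    (hΩ : IsOpen Ω) (hx : x ∈ Ω) (hG : (G x).PosSemidef) : shrinkerOp G f x ≤ 0 := by
  obtain ⟨B, hB⟩ := CStarAlgebra.nonneg_iff_eq_star_mul_self.1 hG.nonneg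
  have h1 : ∑ i, ∑ j, G x i j * pd2 f i j x
      = ∑ k, ∑ i, ∑ j, B k i * B k j * pd2 f i j x := by
    conv_rhs => rw [Finset.sum_comm]
    refine Finset.sum_congr rfl fun i _ => ?_
    conv_rhs => rw [Finset.sum_comm]
    refine Finset.sum_congr rfl fun j _ => ?_
    rw [hB, mul_apply, Finset.sum_mul]
    rfl
  have h2 : ∀ k, ∑ i, ∑ j, B k i * B k j * pd2 f i j x ≤ 0 := fun k =>
    h.sum_pd2_nonpos hf hΩ hx (WithLp.toLp 2 (B k))
  simp only [shrinkerOp, h.pd_eq_zero, mul_zero, Finset.sum_const_zero, sub_zero, h1]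
  exact Finset.sum_nonpos fun k _ => h2 k

lemma pd_exp (hf : DifferentiableAt ℝ f x) (i : Fin n) :
    pd (fun y => Real.exp (f y)) i x = Real.exp (f x) * pd f i x := by
  simp [pd, fderiv_exp hf]

lemma contDiff_norm_sub_sq (q : EuclideanSpace ℝ (Fin n)) :
    ContDiff ℝ ∞ (fun y => ‖y - q‖ ^ 2) :=
  (contDiff_id.sub contDiff_const).norm_sq ℝ

lemma pd_norm_sub_sq (q : EuclideanSpace ℝ (Fin n)) (i : Fin n) :
    pd (fun y => ‖y - q‖ ^ 2) i x = 2 * (x i - q i) := by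
  have h : HasFDerivAt (fun y => ‖y - q‖ ^ 2) _ x := ((hasFDerivAt_id x).sub_const q).norm_sq
  rw [pd, h.fderiv]
  simp [EuclideanSpace.inner_single_right]

lemma shrinkerOp_exp_neg_norm_sub_sq (q : EuclideanSpace ℝ (Fin n)) (α : ℝ) :
    shrinkerOp G (fun y => Real.exp (-α * ‖y - q‖ ^ 2)) x
      = α * Real.exp (-α * ‖x - q‖ ^ 2) *
        (4 * α * ∑ i, ∑ j, G x i j * ((x i - q i) * (x j - q j))
          + (∑ i, x i * (x i - q i) - 2 * ∑ i, G x i i)) := by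
  have hd : ∀ x, DifferentiableAt ℝ (fun y => ‖y - q‖ ^ 2) x := fun x =>
    (contDiff_norm_sub_sq q).differentiable (by simp) x
  have h1 : ∀ j x, pd (fun y => Real.exp (-α * ‖y - q‖ ^ 2)) j x
      = Real.exp (-α * ‖x - q‖ ^ 2) * (-2 * α * (x j - q j)) := by
    intro j x
    rw [pd_exp ((hd x).const_mul _), pd_const_mul (hd x), pd_norm_sub_sq]
    ring
  have h2 : ∀ i j, pd2 (fun y => Real.exp (-α * ‖y - q‖ ^ 2)) i j x
      = Real.exp (-α * ‖x - q‖ ^ 2) *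
        (4 * α ^ 2 * ((x i - q i) * (x j - q j)) - 2 * α * if j = i then 1 else 0) := by
    intro i j
    have hc : DifferentiableAt ℝ (fun y : EuclideanSpace ℝ (Fin n) => y j) x :=
      (contDiff_coord j).differentiable (by simp) x
    rw [pd2, funext (h1 j), pd_mul ((hd x).const_mul _).exp
      ((hc.sub_const _).const_mul _), h1, pd_const_mul (hc.sub_const _),
      pd_sub hc (differentiableAt_const _), pd_coord, pd_const]
    ring
  have h3 : ∑ i, ∑ j, G x i j * (if j = i then (1 : ℝ) else 0) = ∑ i, G x i i := by simp
  have h4 : ∑ i, ∑ j, G x i j * (Real.exp (-α * ‖x - q‖ ^ 2) *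
        (4 * α ^ 2 * ((x i - q i) * (x j - q j)) - 2 * α * if j = i then 1 else 0))
      = Real.exp (-α * ‖x - q‖ ^ 2) * (4 * α ^ 2 * ∑ i, ∑ j, G x i j * ((x i - q i) * (x j - q j))
        - 2 * α * ∑ i, ∑ j, G x i j * (if j = i then (1 : ℝ) else 0)) := by
    simp only [Finset.mul_sum, ← Finset.sum_sub_distrib]
    refine Finset.sum_congr rfl fun i _ => Finset.sum_congr rfl fun j _ => ?_
    ring
  have h5 : ∑ i, x i * (Real.exp (-α * ‖x - q‖ ^ 2) * (-2 * α * (x i - q i)))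
      = Real.exp (-α * ‖x - q‖ ^ 2) * (-2 * α) * ∑ i, x i * (x i - q i) := by
    simp only [Finset.mul_sum]
    refine Finset.sum_congr rfl fun i _ => ?_
    ring
  simp only [shrinkerOp, h1, h2, h4, h3, h5]
  ring

/-- A solution cannot have a strict maximum over a closed ball at a boundary point of the ball at
which it is globally maximal. -/
lemma false_of_strict_max_on_closedBall (hΩ : IsOpen Ω) (hG : ∀ x ∈ Ω, (G x).PosDef)
    (hGc : ∀ i j, ContinuousOn (fun x => G x i j) Ω) (hf : ContDiffOn ℝ ∞ f Ω)
    (hL : ∀ x ∈ Ω, 0 ≤ shrinkerOp G f x) {y q : EuclideanSpace ℝ (Fin n)} (hy : y ∈ Ω)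
    (hyq : y ≠ q) (hmax : ∀ z ∈ Ω, f z ≤ f y)
    (hlt : ∀ z ∈ Ω, ‖z - q‖ ≤ ‖y - q‖ → z ≠ y → f z < f y) : False := by
  have hcoord : ∀ i, Continuous fun z : EuclideanSpace ℝ (Fin n) => z i := fun i =>
    (contDiff_coord i).continuous
  have hGy : ∀ i j, ContinuousAt (fun x => G x i j) y := fun i j =>
    (hGc i j).continuousAt (hΩ.mem_nhds hy)
  set Q : EuclideanSpace ℝ (Fin n) → ℝ := fun x => ∑ i, ∑ j, G x i j * ((x i - q i) * (x j - q j))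
  set R : EuclideanSpace ℝ (Fin n) → ℝ := fun x => ∑ i, x i * (x i - q i) - 2 * ∑ i, G x i i
  have hQc : ContinuousAt Q y := by
    refine tendsto_finsetSum _ fun i _ => tendsto_finsetSum _ fun j _ => (hGy i j).mul ?_
    exact (((hcoord i).sub continuous_const).mul ((hcoord j).sub continuous_const)).continuousAt
  have hRc : ContinuousAt R y := by
    refine ContinuousAt.sub ?_ (ContinuousAt.mul continuousAt_const
      (tendsto_finsetSum _ fun i _ => hGy i i))
    exact (continuous_finsetSum _ fun i _ =>
      (hcoord i).mul ((hcoord i).sub continuous_const)).continuousAt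
  have hQy : 0 < Q y := by
    have hne : (fun i => y i - q i) ≠ 0 := by
      intro h
      apply hyq
      ext i
      have := congrFun h i
      simp only [Pi.zero_apply] at this
      linarith
    have := (hG y hy).dotProduct_mulVec_pos hne
    simp only [dotProduct, mulVec, Finset.mul_sum, star_trivial] at this
    refine this.trans_eq ?_
    refine Finset.sum_congr rfl fun i _ => Finset.sum_congr rfl fun j _ => ?_
    ring
  obtain ⟨ρ, hρ, hball⟩ : ∃ ρ > 0, closedBall y ρ ⊆
      {z | z ∈ Ω ∧ Q y / 2 < Q z ∧ R y - 1 < R z} := by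
    refine nhds_basis_closedBall.mem_iff.1 ?_
    filter_upwards [hΩ.mem_nhds hy, hQc.eventually (lt_mem_nhds (half_lt_self hQy)),
      hRc.eventually (lt_mem_nhds (sub_one_lt (R y)))] with z h1 h2 h3 using ⟨h1, h2, h3⟩
  obtain ⟨α, hα, hαR⟩ : ∃ α > 0, 0 < 2 * α * Q y + (R y - 1) := by
    refine ⟨(|R y| + 2) / Q y, by positivity, ?_⟩
    have := neg_abs_le (R y)
    have h2 : 2 * ((|R y| + 2) / Q y) * Q y = 2 * (|R y| + 2) := by field_simp
    rw [h2]
    have := abs_nonneg (R y)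
    linarith
  set h : EuclideanSpace ℝ (Fin n) → ℝ := fun z => Real.exp (-α * ‖z - q‖ ^ 2)
  have hh : ContDiff ℝ ∞ h := (contDiff_const.mul (contDiff_norm_sub_sq q)).exp
  have hh1 : ∀ z, h z ≤ 1 := fun z => Real.exp_le_one_iff.2 (by
    have := mul_nonneg hα.le (sq_nonneg ‖z - q‖)
    linarith)
  have hh0 : ∀ z, 0 < h z := fun z => Real.exp_pos _
  have hLh : ∀ z ∈ closedBall y ρ, 0 < shrinkerOp G h z := by
    intro z hz
    obtain ⟨_, h2, h3⟩ := hball hz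
    rw [shrinkerOp_exp_neg_norm_sub_sq]
    refine mul_pos (mul_pos hα (Real.exp_pos _)) ?_
    have : 4 * α * (Q y / 2) < 4 * α * Q z := by gcongr
    change 0 < 4 * α * Q z + R z
    linarith
  have hballΩ : closedBall y ρ ⊆ Ω := fun z hz => (hball hz).1
  obtain ⟨δ, hδ, hδf⟩ : ∃ δ > 0, ∀ z ∈ sphere y ρ ∩ closedBall q ‖y - q‖, f z ≤ f y - δ := by
    have hK : IsCompact (sphere y ρ ∩ closedBall q ‖y - q‖) :=
      (isCompact_sphere y ρ).inter_right isClosed_closedBall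
    rcases (sphere y ρ ∩ closedBall q ‖y - q‖).eq_empty_or_nonempty with he | hne
    · exact ⟨1, one_pos, by simp [he]⟩
    · obtain ⟨z, hz, hzmax⟩ := hK.exists_isMaxOn hne (hf.continuousOn.mono fun z hz =>
        hballΩ (sphere_subset_closedBall hz.1))
      refine ⟨f y - f z, sub_pos.2 (hlt z (hballΩ (sphere_subset_closedBall hz.1)) ?_ ?_), ?_⟩
      · simpa [dist_eq_norm] using hz.2
      · rintro rfl
        have := hz.1
        simp only [mem_sphere, dist_self] at this
        exact hρ.ne this
      · intro w hw
        have : f w ≤ f z := hzmax hw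
        linarith
  have hF : ContDiffOn ℝ ∞ (fun z => f z + δ / 2 * h z) Ω :=
    hf.add (contDiffOn_const.mul hh.contDiffOn)
  obtain ⟨z, hz, hzmax⟩ := (isCompact_closedBall y ρ).exists_isMaxOn ⟨y, mem_closedBall_self hρ.le⟩
    (hF.continuousOn.mono hballΩ)
  have hzy : f y + δ / 2 * h y ≤ f z + δ / 2 * h z := hzmax (mem_closedBall_self hρ.le)
  have hzin : z ∈ ball y ρ := by
    by_contra hcon
    have hzs : z ∈ sphere y ρ := le_antisymm hz (not_lt.1 hcon)
    by_cases hzq : ‖z - q‖ ≤ ‖y - q‖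
    · have h1 := hδf z ⟨hzs, by simpa [dist_eq_norm] using hzq⟩
      have h2 : δ / 2 * h z ≤ δ / 2 * 1 := by gcongr; exact hh1 z
      have h3 : 0 < δ / 2 * h y := mul_pos (half_pos hδ) (hh0 y)
      linarith
    · have h1 := hmax z (hballΩ hz)
      have h2 : h z < h y := by
        refine Real.exp_lt_exp.2 ?_
        have : ‖y - q‖ ^ 2 < ‖z - q‖ ^ 2 := by
          gcongr
          exact not_le.1 hzq
        nlinarith
      have h3 : δ / 2 * h z < δ / 2 * h y := by gcongr
      linarith
  have hloc : IsLocalMax (fun z => f z + δ / 2 * h z) z :=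
    hzmax.isLocalMax (Filter.mem_of_superset (isOpen_ball.mem_nhds hzin) ball_subset_closedBall)
  have h1 := hloc.shrinkerOp_nonpos hF hΩ (hballΩ hz) (hG z (hballΩ hz)).posSemidef
  rw [shrinkerOp_add_const_mul hf hh.contDiffOn hΩ (hballΩ hz)] at h1
  have h2 := hL z (hballΩ hz)
  have h3 := mul_pos (half_pos hδ) (hLh z hz)
  linarith

/-- The strong maximum principle. -/
theorem eqOn_of_shrinkerOp_nonneg (hΩ : IsOpen Ω) (hΩc : IsPreconnected Ω)
    (hG : ∀ x ∈ Ω, (G x).PosDef) (hGc : ∀ i j, ContinuousOn (fun x => G x i j) Ω)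
    (hf : ContDiffOn ℝ ∞ f Ω) (hL : ∀ x ∈ Ω, 0 ≤ shrinkerOp G f x)
    {x₀ : EuclideanSpace ℝ (Fin n)} (hx₀ : x₀ ∈ Ω) (hmax : ∀ x ∈ Ω, f x ≤ f x₀) :
    ∀ x ∈ Ω, f x = f x₀ := by
  have hopen : IsOpen {x | x ∈ Ω ∧ f x = f x₀} := by
    rw [Metric.isOpen_iff]
    rintro p ⟨hp, hfp⟩
    obtain ⟨r, hr, hrΩ⟩ := Metric.isOpen_iff.1 hΩ p hp
    refine ⟨r / 2, half_pos hr, fun q hq => ?_⟩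
    have hqp : dist q p < r / 2 := hq
    have hqΩ : closedBall q (dist q p) ⊆ Ω := by
      refine fun z hz => hrΩ ?_
      have hz' : dist z q ≤ dist q p := hz
      have := dist_triangle z q p
      rw [mem_ball]
      linarith
    have hqm : q ∈ Ω := hqΩ (mem_closedBall_self dist_nonneg)
    refine ⟨hqm, ?_⟩
    by_contra hne
    have hK : IsCompact (closedBall q (dist q p) ∩ f ⁻¹' {f x₀}) := by
      refine (isCompact_closedBall _ _).of_isClosed_subset ?_ Set.inter_subset_left
      exact (hf.continuousOn.mono hqΩ).preimage_isClosed_of_isClosed isClosed_closedBall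
        isClosed_singleton
    obtain ⟨y, ⟨hyb, hyf⟩, hymin⟩ := hK.exists_isMinOn (f := fun z => dist z q)
      ⟨p, by rw [mem_closedBall, dist_comm], hfp⟩ (continuous_id.dist continuous_const).continuousOn
    have hyf' : f y = f x₀ := hyf
    have hyq : y ≠ q := fun h => hne (h ▸ hyf')
    set b := (1 / 2 : ℝ) • (y - q) with hb
    have hyb' : y - q = (2 : ℝ) • b := by rw [hb, smul_smul]; norm_num
    refine false_of_strict_max_on_closedBall hΩ hG hGc hf hL (hqΩ hyb) (q := q + b) ?_
      (fun z hz => hyf' ▸ hmax z hz) ?_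
    · intro h
      have h1 : b = 0 := by
        have : y - q = b := by rw [h]; abel
        rw [hyb', two_smul] at this
        simpa using this
      rw [h1, smul_zero] at hyb'
      exact hyq (sub_eq_zero.1 hyb')
    · intro z hz hzb hzy
      refine lt_of_le_of_ne (hyf' ▸ hmax z hz) fun hfz => ?_
      have h1 : y - (q + b) = b := by
        rw [← sub_sub, hyb', two_smul]; abel
      rw [h1] at hzb
      set a := z - (q + b) with ha
      have hab : a - b ≠ 0 := by
        intro h
        apply hzy
        have : z - y = a - b := by
          calc z - y = a - (y - (q + b)) := by rw [ha]; abel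
            _ = a - b := by rw [h1]
        exact sub_eq_zero.1 (this.trans h)
      have h2 := norm_sub_sq_real a b
      have h3 := norm_add_sq_real a b
      have h4 : 0 < ‖a - b‖ ^ 2 := by positivity
      have h5 : ‖a‖ ^ 2 ≤ ‖b‖ ^ 2 := by gcongr
      have h6 : ‖z - q‖ < ‖y - q‖ := by
        have : z - q = a + b := by rw [ha]; abel
        rw [this, hyb']
        refine lt_of_pow_lt_pow_left₀ 2 (norm_nonneg _) ?_
        rw [norm_smul, mul_pow]
        norm_num
        linarith
      have hyd : dist y q ≤ dist q p := hyb
      rw [← dist_eq_norm, ← dist_eq_norm] at h6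
      have : dist y q ≤ dist z q := hymin ⟨(h6.le.trans hyd : dist z q ≤ dist q p), hfz.trans hyf'⟩
      linarith
  have hopen' : IsOpen (Ω ∩ f ⁻¹' {f x₀}ᶜ) :=
    hf.continuousOn.isOpen_inter_preimage hΩ isOpen_compl_singleton
  have hsub := hΩc.subset_left_of_subset_union hopen hopen'
    (Set.disjoint_left.2 fun x h1 h2 => h2.2 h1.2)
    (fun x hx => by
      by_cases h : f x = f x₀
      · exact Or.inl ⟨hx, h⟩
      · exact Or.inr ⟨hx, h⟩)
    ⟨x₀, hx₀, hx₀, rfl⟩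
  exact fun x hx => (hsub hx).2

end MaximumPrinciple

section ShrinkerPotential

open Matrix Metric

variable {n : ℕ} {Ω : Set (EuclideanSpace ℝ (Fin n))}
  {u : EuclideanSpace ℝ (Fin n) → ℝ} {x : EuclideanSpace ℝ (Fin n)}

/-- The function `(1/2) x · ∇u - u`. -/
noncomputable def shrinkerPhase (u : EuclideanSpace ℝ (Fin n) → ℝ)
    (x : EuclideanSpace ℝ (Fin n)) : ℝ :=
  (1 / 2) * (∑ i, x i * pd u i x) - u x

/-- The inverse of the metric `I + (D²u)²` induced on the gradient graph of `u`. -/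
noncomputable def inverseMetric (u : EuclideanSpace ℝ (Fin n) → ℝ)
    (x : EuclideanSpace ℝ (Fin n)) : Matrix (Fin n) (Fin n) ℝ :=
  (1 + hessM u x * hessM u x)⁻¹

/-- The squared norm of the position vector `(x, ∇u(x))`. -/
noncomputable def positionNormSq (u : EuclideanSpace ℝ (Fin n) → ℝ)
    (x : EuclideanSpace ℝ (Fin n)) : ℝ :=
  ∑ a, (x a * x a + pd u a x * pd u a x)

lemma differentiableAt_coord (i : Fin n) :
    DifferentiableAt ℝ (fun y : EuclideanSpace ℝ (Fin n) => y i) x :=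
  (contDiff_coord i).differentiable (by simp) x

lemma ContDiffOn.contDiffOn_pd2 (hu : ContDiffOn ℝ ∞ u Ω) (hΩ : IsOpen Ω) (i j : Fin n) :
    ContDiffOn ℝ ∞ (pd2 u i j) Ω :=
  (hu.contDiffOn_pd hΩ j).contDiffOn_pd hΩ i

lemma contDiffOn_shrinkerPhase (hu : ContDiffOn ℝ ∞ u Ω) (hΩ : IsOpen Ω) :
    ContDiffOn ℝ ∞ (shrinkerPhase u) Ω :=
  (contDiffOn_const.mul (ContDiffOn.sum fun i _ =>
    (contDiff_coord i).contDiffOn.mul (hu.contDiffOn_pd hΩ i))).sub hu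

lemma contDiffOn_positionNormSq (hu : ContDiffOn ℝ ∞ u Ω) (hΩ : IsOpen Ω) :
    ContDiffOn ℝ ∞ (positionNormSq u) Ω :=
  ContDiffOn.sum fun i _ =>
    ((contDiff_coord i).mul (contDiff_coord i)).contDiffOn.add
      ((hu.contDiffOn_pd hΩ i).mul (hu.contDiffOn_pd hΩ i))

lemma isHermitian_hessM (hu : ContDiffOn ℝ ∞ u Ω) (hΩ : IsOpen Ω) (hx : x ∈ Ω) :
    (hessM u x).IsHermitian := by
  ext i j
  exact hu.pd2_comm hΩ hx j i

lemma posDef_inverseMetric (hu : ContDiffOn ℝ ∞ u Ω) (hΩ : IsOpen Ω) (hx : x ∈ Ω) :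
    (inverseMetric u x).PosDef :=
  (isHermitian_hessM hu hΩ hx).posDef_one_add_mul_self.inv

lemma continuousOn_inverseMetric (hu : ContDiffOn ℝ ∞ u Ω) (hΩ : IsOpen Ω) (i j : Fin n) :
    ContinuousOn (fun x => inverseMetric u x i j) Ω := by
  have hH : ContinuousOn (hessM u) Ω :=
    continuousOn_pi.2 fun i => continuousOn_pi.2 fun j => (hu.contDiffOn_pd2 hΩ i j).continuousOn
  have hM : ContinuousOn (fun x => 1 + hessM u x * hessM u x) Ω :=
    continuousOn_const.add (hH.mul hH)
  have hdet : ContinuousOn (fun x => (1 + hessM u x * hessM u x).det) Ω :=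
    (continuous_id.matrix_det).comp_continuousOn hM
  have hadj : ContinuousOn (fun x => (1 + hessM u x * hessM u x).adjugate i j) Ω :=
    ((continuous_id.matrix_adjugate).matrix_elem i j).comp_continuousOn hM
  have hinv := hdet.inv₀ fun x hx =>
    (isHermitian_hessM hu hΩ hx).posDef_one_add_mul_self.det_pos.ne'
  refine (hinv.mul hadj).congr fun x _ => ?_
  simp [inverseMetric, inv_def]

lemma pd_shrinkerPhase (hu : ContDiffOn ℝ ∞ u Ω) (hΩ : IsOpen Ω) (hx : x ∈ Ω) (k : Fin n) :
    pd (shrinkerPhase u) k x = (1 / 2) * (∑ i, x i * pd2 u i k x) - (1 / 2) * pd u k x := by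
  have hp : ∀ i, DifferentiableAt ℝ (pd u i) x := fun i =>
    (hu.contDiffOn_pd hΩ i).differentiableAt_of_isOpen hΩ hx
  have hs : ∀ i ∈ Finset.univ,
      DifferentiableAt ℝ (fun y : EuclideanSpace ℝ (Fin n) => y i * pd u i y) x :=
    fun i _ => (differentiableAt_coord i).mul (hp i)
  have h1 : ∀ i, pd (fun y : EuclideanSpace ℝ (Fin n) => y i * pd u i y) k x
      = x i * pd2 u i k x + (if i = k then 1 else 0) * pd u i x := by
    intro i
    rw [pd_mul (differentiableAt_coord i) (hp i), pd_coord, hu.pd2_comm hΩ hx i k]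
    rfl
  change pd (fun y => (1 / 2) * (∑ i, y i * pd u i y) - u y) k x = _
  rw [pd_sub ((DifferentiableAt.fun_sum hs).const_mul _) (hu.differentiableAt_of_isOpen hΩ hx),
    pd_const_mul (DifferentiableAt.fun_sum hs), pd_sum hs]
  simp only [h1, Finset.sum_add_distrib, ite_mul, one_mul, zero_mul, Finset.sum_ite_eq',
    Finset.mem_univ, if_true]
  ring

lemma pd_pd2_comm (hu : ContDiffOn ℝ ∞ u Ω) (hΩ : IsOpen Ω) (hx : x ∈ Ω) (i j k : Fin n) :
    pd (pd2 u i j) k x = pd (pd2 u k j) i x :=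
  (hu.contDiffOn_pd hΩ j).pd2_comm hΩ hx k i

lemma pd_pd2_symm (hu : ContDiffOn ℝ ∞ u Ω) (hΩ : IsOpen Ω) (hx : x ∈ Ω) (i j k : Fin n) :
    pd (pd2 u i j) k x = pd (pd2 u j i) k x :=
  Set.EqOn.pd_eq (fun _ hy => hu.pd2_comm hΩ hy i j) hΩ k hx

lemma pd2_shrinkerPhase (hu : ContDiffOn ℝ ∞ u Ω) (hΩ : IsOpen Ω) (hx : x ∈ Ω) (l k : Fin n) :
    pd2 (shrinkerPhase u) l k x = (1 / 2) * ∑ i, x i * pd (pd2 u l k) i x := by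
  have hp : ∀ i, DifferentiableAt ℝ (pd2 u i k) x := fun i =>
    (hu.contDiffOn_pd2 hΩ i k).differentiableAt_of_isOpen hΩ hx
  have hs : ∀ i ∈ Finset.univ,
      DifferentiableAt ℝ (fun y : EuclideanSpace ℝ (Fin n) => y i * pd2 u i k y) x :=
    fun i _ => (differentiableAt_coord i).mul (hp i)
  have hk : DifferentiableAt ℝ (pd u k) x :=
    (hu.contDiffOn_pd hΩ k).differentiableAt_of_isOpen hΩ hx
  have h1 : ∀ i, pd (fun y : EuclideanSpace ℝ (Fin n) => y i * pd2 u i k y) l x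
      = x i * pd (pd2 u l k) i x + (if i = l then 1 else 0) * pd2 u i k x := by
    intro i
    rw [pd_mul (differentiableAt_coord i) (hp i), pd_coord, pd_pd2_comm hu hΩ hx i k l]
  have h2 : pd2 (shrinkerPhase u) l k x
      = pd (fun y => (1 / 2) * (∑ i, y i * pd2 u i k y) - (1 / 2) * pd u k y) l x :=
    Set.EqOn.pd_eq (fun y hy => pd_shrinkerPhase hu hΩ hy k) hΩ l hx
  have h3 : pd (pd u k) l x = pd2 u l k x := rfl
  rw [h2, pd_sub ((DifferentiableAt.fun_sum hs).const_mul _) (hk.const_mul _),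
    pd_const_mul (DifferentiableAt.fun_sum hs), pd_const_mul hk, pd_sum hs, h3]
  simp only [h1, Finset.sum_add_distrib, ite_mul, one_mul, zero_mul, Finset.sum_ite_eq',
    Finset.mem_univ, if_true]
  ring

/-- The Lagrangian shrinker potential equation on `Ω`. -/
def SolvesShrinkerPotentialEq (u : EuclideanSpace ℝ (Fin n) → ℝ)
    (Ω : Set (EuclideanSpace ℝ (Fin n))) : Prop :=
  ∀ x ∈ Ω, ∀ h : (hessM u x).IsHermitian,
    ∑ i, Real.arctan (h.eigenvalues i) = shrinkerPhase u x

lemma SolvesShrinkerPotentialEq.pd_shrinkerPhase (heq : SolvesShrinkerPotentialEq u Ω)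
    (hu : ContDiffOn ℝ ∞ u Ω) (hΩ : IsOpen Ω) (hx : x ∈ Ω) (k : Fin n) :
    pd (shrinkerPhase u) k x = ∑ i, ∑ j, inverseMetric u x i j * pd (pd2 u i j) k x := by
  set e : EuclideanSpace ℝ (Fin n) := EuclideanSpace.single k 1
  have hmem : ∀ᶠ s in nhds (0 : ℝ), x + s • e ∈ Ω := by
    have : Continuous fun s : ℝ => x + s • e := by fun_prop
    exact this.continuousAt.eventually (by simpa using hΩ.mem_nhds hx)
  have hline : ∀ f : EuclideanSpace ℝ (Fin n) → ℝ, ContDiffOn ℝ ∞ f Ω →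
      HasDerivAt (fun s : ℝ => f (x + s • e)) (pd f k x) 0 := by
    intro f hf
    have := hasDerivAt_comp_line (f := f) (x := x) (v := e) (t := 0)
      (by simpa using hf.differentiableAt_of_isOpen hΩ hx)
    rwa [← fderiv_apply_eq_sum_pd, zero_smul, add_zero] at this
  have key := trace_inv_one_add_sq_mul_eq (A := fun s : ℝ => hessM u (x + s • e))
    (A' := Matrix.of fun i j => pd (pd2 u i j) k x) (θ := fun s : ℝ => shrinkerPhase u (x + s • e))
    (hmem.mono fun s hs => isHermitian_hessM hu hΩ hs)
    (fun i j => hline _ (hu.contDiffOn_pd2 hΩ i j))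
    (hline _ (contDiffOn_shrinkerPhase hu hΩ))
    (hmem.mono fun s hs => heq _ hs)
  rw [← key, zero_smul, add_zero, trace]
  refine Finset.sum_congr rfl fun i _ => ?_
  rw [diag_apply, mul_apply]
  refine Finset.sum_congr rfl fun j _ => ?_
  rw [of_apply, pd_pd2_symm hu hΩ hx j i]
  rfl

lemma SolvesShrinkerPotentialEq.shrinkerOp_shrinkerPhase (heq : SolvesShrinkerPotentialEq u Ω)
    (hu : ContDiffOn ℝ ∞ u Ω) (hΩ : IsOpen Ω) (hx : x ∈ Ω) :
    shrinkerOp (inverseMetric u) (shrinkerPhase u) x = 0 := by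
  have h : ∑ i, x i * pd (shrinkerPhase u) i x
      = ∑ l, ∑ k, ∑ i, x i * (inverseMetric u x l k * pd (pd2 u l k) i x) := by
    simp only [heq.pd_shrinkerPhase hu hΩ hx, Finset.mul_sum]
    rw [Finset.sum_comm]
    exact Finset.sum_congr rfl fun l _ => Finset.sum_comm
  rw [shrinkerOp, h, Finset.mul_sum, ← Finset.sum_sub_distrib]
  refine Finset.sum_eq_zero fun l _ => ?_
  rw [Finset.mul_sum, ← Finset.sum_sub_distrib]
  refine Finset.sum_eq_zero fun k _ => ?_
  rw [pd2_shrinkerPhase hu hΩ hx, sub_eq_zero]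
  simp only [Finset.mul_sum]
  exact Finset.sum_congr rfl fun i _ => by ring

lemma pd_positionNormSq (hu : ContDiffOn ℝ ∞ u Ω) (hΩ : IsOpen Ω) (hx : x ∈ Ω) (j : Fin n) :
    pd (positionNormSq u) j x = 2 * x j + 2 * ∑ a, pd u a x * pd2 u j a x := by
  have hp : ∀ a, DifferentiableAt ℝ (pd u a) x := fun a =>
    (hu.contDiffOn_pd hΩ a).differentiableAt_of_isOpen hΩ hx
  have hc : ∀ a, DifferentiableAt ℝ (fun y : EuclideanSpace ℝ (Fin n) => y a) x :=
    differentiableAt_coord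
  have h1 : ∀ a, pd (fun y : EuclideanSpace ℝ (Fin n) => y a * y a + pd u a y * pd u a y) j x
      = 2 * (x a * if a = j then 1 else 0) + 2 * (pd u a x * pd2 u j a x) := by
    intro a
    rw [pd_add ((hc a).fun_mul (hc a)) ((hp a).fun_mul (hp a)), pd_mul (hc a) (hc a),
      pd_mul (hp a) (hp a), pd_coord]
    change _ + (_ * pd2 u j a x + pd2 u j a x * _) = _
    ring
  change pd (fun y => ∑ a, (y a * y a + pd u a y * pd u a y)) j x = _
  rw [pd_sum fun a _ => ((hc a).fun_mul (hc a)).fun_add ((hp a).fun_mul (hp a))]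
  simp only [h1, Finset.sum_add_distrib, ← Finset.mul_sum]
  simp

lemma pd2_positionNormSq (hu : ContDiffOn ℝ ∞ u Ω) (hΩ : IsOpen Ω) (hx : x ∈ Ω) (i j : Fin n) :
    pd2 (positionNormSq u) i j x = 2 * (1 + hessM u x * hessM u x) j i
      + 2 * ∑ a, pd u a x * pd (pd2 u i j) a x := by
  have hp : ∀ a, DifferentiableAt ℝ (pd u a) x := fun a =>
    (hu.contDiffOn_pd hΩ a).differentiableAt_of_isOpen hΩ hx
  have hp2 : ∀ a, DifferentiableAt ℝ (pd2 u j a) x := fun a =>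
    (hu.contDiffOn_pd2 hΩ j a).differentiableAt_of_isOpen hΩ hx
  have hs : ∀ a ∈ Finset.univ, DifferentiableAt ℝ (fun y => pd u a y * pd2 u j a y) x :=
    fun a _ => (hp a).mul (hp2 a)
  have h1 : ∀ a, pd (fun y => pd u a y * pd2 u j a y) i x
      = pd u a x * pd (pd2 u i j) a x + hessM u x j a * hessM u x a i := by
    intro a
    rw [pd_mul (hp a) (hp2 a), pd_pd2_symm hu hΩ hx j a i, pd_pd2_comm hu hΩ hx a j i]
    change _ + pd2 u i a x * pd2 u j a x = _ + pd2 u j a x * pd2 u a i x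
    rw [hu.pd2_comm hΩ hx i a]
    ring
  have h2 : pd2 (positionNormSq u) i j x
      = pd (fun y => 2 * y j + 2 * ∑ a, pd u a y * pd2 u j a y) i x :=
    Set.EqOn.pd_eq (fun y hy => pd_positionNormSq hu hΩ hy j) hΩ i hx
  rw [h2, pd_add ((differentiableAt_coord j).const_mul _)
    ((DifferentiableAt.fun_sum hs).const_mul _), pd_const_mul (differentiableAt_coord j),
    pd_const_mul (DifferentiableAt.fun_sum hs), pd_sum hs, pd_coord]
  simp only [h1, Finset.sum_add_distrib, Matrix.add_apply, mul_apply, one_apply]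
  ring

lemma SolvesShrinkerPotentialEq.shrinkerOp_positionNormSq (heq : SolvesShrinkerPotentialEq u Ω)
    (hu : ContDiffOn ℝ ∞ u Ω) (hΩ : IsOpen Ω) (hx : x ∈ Ω) :
    shrinkerOp (inverseMetric u) (positionNormSq u) x = 2 * n - positionNormSq u x := by
  have h1 : ∑ i, ∑ j, inverseMetric u x i j * (1 + hessM u x * hessM u x) j i = n := by
    have : inverseMetric u x * (1 + hessM u x * hessM u x) = 1 :=
      nonsing_inv_mul _ (isHermitian_hessM hu hΩ hx).posDef_one_add_mul_self.det_pos.ne'.isUnit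
    have := congrArg trace this
    simpa [trace, mul_apply] using this
  have h2 : ∑ i, ∑ j, inverseMetric u x i j * ∑ a, pd u a x * pd (pd2 u i j) a x
      = ∑ a, pd u a x * pd (shrinkerPhase u) a x := by
    simp only [heq.pd_shrinkerPhase hu hΩ hx, Finset.mul_sum]
    conv_rhs => rw [Finset.sum_comm]
    refine Finset.sum_congr rfl fun i _ => ?_
    conv_rhs => rw [Finset.sum_comm]
    exact Finset.sum_congr rfl fun j _ => Finset.sum_congr rfl fun a _ => by ring
  have h3 : ∑ i, ∑ j, inverseMetric u x i j * pd2 (positionNormSq u) i j x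
      = 2 * n + 2 * ∑ a, pd u a x * pd (shrinkerPhase u) a x := by
    simp only [pd2_positionNormSq hu hΩ hx, mul_add, Finset.sum_add_distrib,
      mul_left_comm _ (2 : ℝ), ← Finset.mul_sum]
    rw [← h1, ← h2]
  have h4 : ∑ j, x j * pd (positionNormSq u) j x
      = 2 * (∑ j, x j * x j) + 2 * ∑ j, x j * ∑ a, pd u a x * pd2 u j a x := by
    simp only [pd_positionNormSq hu hΩ hx, mul_add, Finset.sum_add_distrib,
      mul_left_comm _ (2 : ℝ), ← Finset.mul_sum]
  have h5 : ∑ a, pd u a x * pd (shrinkerPhase u) a x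
      = (1 / 2) * (∑ j, x j * ∑ a, pd u a x * pd2 u j a x)
        - (1 / 2) * ∑ a, pd u a x * pd u a x := by
    simp only [_root_.pd_shrinkerPhase hu hΩ hx, mul_sub, Finset.sum_sub_distrib, Finset.mul_sum]
    congr 1
    · rw [Finset.sum_comm]
      exact Finset.sum_congr rfl fun j _ => Finset.sum_congr rfl fun a _ => by ring
    · exact Finset.sum_congr rfl fun a _ => by ring
  rw [shrinkerOp, h3, h4, h5, positionNormSq, Finset.sum_add_distrib]
  ring

end ShrinkerPotential

section Rigidity

open Matrix Metric

variable {n : ℕ} {Ω : Set (EuclideanSpace ℝ (Fin n))}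
  {u : EuclideanSpace ℝ (Fin n) → ℝ} {x : EuclideanSpace ℝ (Fin n)}

lemma positionNormSq_eq (x : EuclideanSpace ℝ (Fin n)) :
    positionNormSq u x = ‖x‖ ^ 2 + ∑ a, pd u a x ^ 2 := by
  simp only [positionNormSq, Finset.sum_add_distrib, ← sq, EuclideanSpace.real_norm_sq_eq]

lemma positionNormSq_nonneg (x : EuclideanSpace ℝ (Fin n)) : 0 ≤ positionNormSq u x := by
  rw [positionNormSq_eq]
  positivity

lemma SolvesShrinkerPotentialEq.abs_shrinkerPhase_le (heq : SolvesShrinkerPotentialEq u Ω)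
    (hu : ContDiffOn ℝ ∞ u Ω) (hΩ : IsOpen Ω) (hx : x ∈ Ω) :
    |shrinkerPhase u x| ≤ n * (Real.pi / 2) := by
  rw [← heq x hx (isHermitian_hessM hu hΩ hx)]
  refine (Finset.abs_sum_le_sum_abs _ _).trans ?_
  refine (Finset.sum_le_card_nsmul _ _ (Real.pi / 2) fun i _ => ?_).trans_eq (by simp)
  exact abs_le.2 ⟨(Real.neg_pi_div_two_lt_arctan _).le, (Real.arctan_lt_pi_div_two _).le⟩

/-- A set on which the gradient is bounded stays away from the boundary. -/
lemma closure_subset_of_gradient_bounded (hΩ : IsOpen Ω)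
    (hbd : ∀ z ∈ frontier Ω, Filter.Tendsto (fun x => Real.sqrt (∑ i, (pd u i x) ^ 2))
      (nhdsWithin z Ω) Filter.atTop)
    {S : Set (EuclideanSpace ℝ (Fin n))} (hS : S ⊆ Ω) {R : ℝ}
    (hR : ∀ x ∈ S, ∑ i, (pd u i x) ^ 2 ≤ R) : closure S ⊆ Ω := by
  intro z hz
  by_contra hzΩ
  have hzf : z ∈ frontier Ω := by
    rw [hΩ.frontier_eq]
    exact ⟨closure_mono hS hz, hzΩ⟩
  have : (nhdsWithin z S).NeBot := mem_closure_iff_nhdsWithin_neBot.1 hz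
  have h1 := ((hbd z hzf).mono_left (nhdsWithin_mono z hS)).eventually_gt_atTop (Real.sqrt R)
  obtain ⟨x, hx, hxS⟩ := (h1.and self_mem_nhdsWithin).exists
  exact hx.not_ge (Real.sqrt_le_sqrt (hR x hxS))

lemma isCompact_positionNormSq_le (hu : ContDiffOn ℝ ∞ u Ω) (hΩ : IsOpen Ω)
    (hbd : ∀ z ∈ frontier Ω, Filter.Tendsto (fun x => Real.sqrt (∑ i, (pd u i x) ^ 2))
      (nhdsWithin z Ω) Filter.atTop) (R : ℝ) :
    IsCompact {x | x ∈ Ω ∧ positionNormSq u x ≤ R} := by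
  have hsum : ∀ x : EuclideanSpace ℝ (Fin n), 0 ≤ ∑ i, (pd u i x) ^ 2 := fun x => by positivity
  refine isCompact_of_isClosed_isBounded (isClosed_of_closure_subset fun z hz => ?_) ?_
  · have hzΩ : z ∈ Ω := by
      refine closure_subset_of_gradient_bounded hΩ hbd (fun x hx => hx.1) (R := R) ?_ hz
      rintro x ⟨_, hx⟩
      rw [positionNormSq_eq] at hx
      linarith [sq_nonneg ‖x‖]
    refine ⟨hzΩ, ?_⟩
    have : (nhdsWithin z {x | x ∈ Ω ∧ positionNormSq u x ≤ R}).NeBot :=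
      mem_closure_iff_nhdsWithin_neBot.1 hz
    have hc : ContinuousAt (positionNormSq u) z :=
      (contDiffOn_positionNormSq hu hΩ).continuousOn.continuousAt (hΩ.mem_nhds hzΩ)
    have hc' : Filter.Tendsto (positionNormSq u)
        (nhdsWithin z {x | x ∈ Ω ∧ positionNormSq u x ≤ R}) (nhds (positionNormSq u z)) :=
      hc.mono_left nhdsWithin_le_nhds
    refine le_of_tendsto hc' ?_
    filter_upwards [self_mem_nhdsWithin] with x hx using hx.2
  · refine (isBounded_closedBall (x := 0) (r := Real.sqrt R)).subset ?_
    rintro x ⟨_, hx⟩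
    rw [positionNormSq_eq] at hx
    rw [mem_closedBall_zero_iff]
    exact Real.le_sqrt_of_sq_le (by linarith [hsum x])

/-- The phase attains its maximum because it is bounded and the squared norm of the position vector
is a proper barrier. -/
lemma SolvesShrinkerPotentialEq.exists_forall_shrinkerPhase_le
    (heq : SolvesShrinkerPotentialEq u Ω) (hu : ContDiffOn ℝ ∞ u Ω) (hΩ : IsOpen Ω)
    (hΩne : Ω.Nonempty)
    (hbd : ∀ z ∈ frontier Ω, Filter.Tendsto (fun x => Real.sqrt (∑ i, (pd u i x) ^ 2))
      (nhdsWithin z Ω) Filter.atTop) :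
    ∃ x₀ ∈ Ω, ∀ x ∈ Ω, shrinkerPhase u x ≤ shrinkerPhase u x₀ := by
  have hφ := contDiffOn_shrinkerPhase hu hΩ
  have hw := contDiffOn_positionNormSq hu hΩ
  have hpert : ∀ ε > 0, ∃ z ∈ Ω, positionNormSq u z ≤ 2 * n ∧ ∀ x ∈ Ω,
      shrinkerPhase u x + -ε * positionNormSq u x
        ≤ shrinkerPhase u z + -ε * positionNormSq u z := by
    intro ε hε
    obtain ⟨y, hy⟩ := hΩne
    set ψ : EuclideanSpace ℝ (Fin n) → ℝ :=
      fun x => shrinkerPhase u x + -ε * positionNormSq u x with hψdef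
    have hψ : ContDiffOn ℝ ∞ ψ Ω := hφ.add (contDiffOn_const.mul hw)
    set R : ℝ := (n * (Real.pi / 2) - ψ y) / ε
    have hR : ∀ x ∈ Ω, ψ y ≤ ψ x → positionNormSq u x ≤ R := by
      intro x hx hxy
      rw [le_div_iff₀ hε]
      have := (abs_le.1 (heq.abs_shrinkerPhase_le hu hΩ hx)).2
      simp only [hψdef] at hxy ⊢
      linarith
    obtain ⟨z, hz, hzmax⟩ := (isCompact_positionNormSq_le hu hΩ hbd R).exists_isMaxOn
      ⟨y, hy, hR y hy le_rfl⟩ (hψ.continuousOn.mono fun x hx => hx.1)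
    have hzy : ψ y ≤ ψ z := hzmax ⟨hy, hR y hy le_rfl⟩
    have hmax : ∀ x ∈ Ω, ψ x ≤ ψ z := by
      intro x hx
      rcases le_total (ψ y) (ψ x) with h | h
      · exact hzmax ⟨hx, hR x hx h⟩
      · exact h.trans hzy
    refine ⟨z, hz.1, ?_, hmax⟩
    have hloc : IsLocalMax ψ z := Filter.mem_of_superset (hΩ.mem_nhds hz.1) hmax
    have h1 := hloc.shrinkerOp_nonpos hψ hΩ hz.1 (posDef_inverseMetric hu hΩ hz.1).posSemidef
    rw [shrinkerOp_add_const_mul hφ hw hΩ hz.1, heq.shrinkerOp_shrinkerPhase hu hΩ hz.1,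
      heq.shrinkerOp_positionNormSq hu hΩ hz.1] at h1
    by_contra! hcon
    have := mul_pos hε (sub_pos.2 hcon)
    linarith
  obtain ⟨z₁, hz₁, hz₁w, -⟩ := hpert 1 one_pos
  obtain ⟨x₀, hx₀, hmax⟩ := (isCompact_positionNormSq_le hu hΩ hbd (2 * n)).exists_isMaxOn
    ⟨z₁, hz₁, hz₁w⟩ (hφ.continuousOn.mono fun x hx => hx.1)
  refine ⟨x₀, hx₀.1, fun x hx => le_of_forall_pos_le_add fun δ hδ => ?_⟩
  have hwx := positionNormSq_nonneg (u := u) x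
  have hε : 0 < δ / (positionNormSq u x + 1) := by positivity
  obtain ⟨z, hz, hzw, hzmax⟩ := hpert _ hε
  have h1 := hzmax x hx
  have h2 : shrinkerPhase u z ≤ shrinkerPhase u x₀ := hmax ⟨hz, hzw⟩
  have h3 := mul_nonneg hε.le (positionNormSq_nonneg (u := u) z)
  have h4 : δ / (positionNormSq u x + 1) * positionNormSq u x ≤ δ := by
    rw [div_mul_eq_mul_div, div_le_iff₀ (by positivity)]
    nlinarith
  linarith

/-- A gradient satisfying Euler's identity is homogeneous of degree one along rays, which never
leave the domain. -/
lemma pd_smul_of_euler (hu : ContDiffOn ℝ ∞ u Ω) (hΩ : IsOpen Ω)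
    (hbd : ∀ z ∈ frontier Ω, Filter.Tendsto (fun x => Real.sqrt (∑ i, (pd u i x) ^ 2))
      (nhdsWithin z Ω) Filter.atTop)
    (heuler : ∀ x ∈ Ω, ∀ k, ∑ i, x i * pd2 u i k x = pd u k x) (hx : x ∈ Ω) {t : ℝ}
    (ht : 0 < t) : t • x ∈ Ω ∧ ∀ k, pd u k (t • x) = t * pd u k x := by
  set A : Set ℝ := {t | 0 < t ∧ t • x ∈ Ω ∧ ∀ k, pd u k (t • x) = t * pd u k x}
  have hcont : Continuous fun s : ℝ => s • x := by fun_prop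
  have hpdc : ∀ k, ∀ s : ℝ, s • x ∈ Ω → ContinuousAt (fun s : ℝ => pd u k (s • x)) s := by
    intro k s hs
    have h : ContinuousAt (pd u k) (s • x) :=
      (hu.contDiffOn_pd hΩ k).continuousOn.continuousAt (hΩ.mem_nhds hs)
    exact ContinuousAt.comp (f := fun s : ℝ => s • x) h hcont.continuousAt
  have hAopen : IsOpen A := by
    rw [Metric.isOpen_iff]
    rintro s ⟨hs, hsΩ, hsk⟩
    obtain ⟨δ, hδ, hball⟩ := Metric.isOpen_iff.1 (isOpen_Ioi.inter (hΩ.preimage hcont)) s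
      (show s ∈ Set.Ioi 0 ∩ (fun s : ℝ => s • x) ⁻¹' Ω from ⟨hs, hsΩ⟩)
    refine ⟨δ, hδ, fun r hr => ⟨(hball hr).1, (hball hr).2, fun k => ?_⟩⟩
    have hder : ∀ r ∈ ball s δ, HasDerivAt (fun r : ℝ => pd u k (r • x) / r) 0 r := by
      intro r hr
      have hr0 : r ≠ 0 := (hball hr).1.ne'
      have hrΩ : r • x ∈ Ω := (hball hr).2
      have h1 := hasDerivAt_comp_line (f := pd u k) (x := 0) (v := x) (t := r)
        (by simpa using (hu.contDiffOn_pd hΩ k).differentiableAt_of_isOpen hΩ hrΩ)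
      simp only [zero_add] at h1
      refine (h1.div (hasDerivAt_id r) hr0).congr_deriv ?_
      have h2 := heuler _ hrΩ k
      simp only [PiLp.smul_apply, smul_eq_mul, mul_assoc, ← Finset.mul_sum] at h2
      change ((∑ i, x i * pd2 u i k (r • x)) * r - pd u k (r • x) * 1) / r ^ 2 = 0
      rw [mul_comm, h2]
      simp
    have h := isOpen_ball.is_const_of_deriv_eq_zero (convex_ball s δ).isPreconnected
      (fun r hr => (hder r hr).differentiableAt.differentiableWithinAt)
      (fun r hr => (hder r hr).deriv) hr (mem_ball_self hδ)
    have hr0 : r ≠ 0 := (hball hr).1.ne'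
    rw [hsk k, mul_div_cancel_left₀ _ hs.ne'] at h
    rw [← h]
    field_simp
  have hsub : Set.Ioi (0 : ℝ) ⊆ A := by
    refine isPreconnected_Ioi.subset_of_closure_inter_subset hAopen
      ⟨1, Set.mem_Ioi.2 one_pos, one_pos, by simpa using hx, by simp⟩ ?_
    rintro s ⟨hsA, hs⟩
    have hsΩ : s • x ∈ Ω := by
      refine closure_subset_of_gradient_bounded hΩ hbd
        (S := (fun r : ℝ => r • x) '' (A ∩ Set.Iio (s + 1)))
        (R := ∑ k, ((s + 1) * pd u k x) ^ 2) ?_ ?_ ?_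
      · rintro _ ⟨r, hr, rfl⟩
        exact hr.1.2.1
      · rintro _ ⟨r, ⟨⟨hr0, -, hrk⟩, hrs⟩, rfl⟩
        refine Finset.sum_le_sum fun k _ => ?_
        rw [hrk k, mul_pow, mul_pow]
        have : r ^ 2 ≤ (s + 1) ^ 2 := by
          have : r ≤ s + 1 := le_of_lt hrs
          gcongr
        gcongr
      · refine image_closure_subset_closure_image hcont ⟨s, ?_, rfl⟩
        rw [Set.inter_comm]
        exact isOpen_Iio.inter_closure ⟨lt_add_one s, hsA⟩
    refine ⟨hs, hsΩ, fun k => ?_⟩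
    have : (nhdsWithin s A).NeBot := mem_closure_iff_nhdsWithin_neBot.1 hsA
    have h1 : Filter.Tendsto (fun r : ℝ => pd u k (r • x)) (nhdsWithin s A)
        (nhds (pd u k (s • x))) := (hpdc k s hsΩ).mono_left nhdsWithin_le_nhds
    have h2 : Filter.Tendsto (fun r : ℝ => r * pd u k x) (nhdsWithin s A)
        (nhds (s * pd u k x)) :=
      (continuous_id.mul continuous_const).continuousAt.mono_left nhdsWithin_le_nhds
    refine tendsto_nhds_unique (h1.congr' ?_) h2
    filter_upwards [self_mem_nhdsWithin] with r hr using hr.2.2 k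
  exact (hsub ht).2

lemma eq_univ_of_euler (hu : ContDiffOn ℝ ∞ u Ω) (hΩ : IsOpen Ω) (hΩne : Ω.Nonempty)
    (hbd : ∀ z ∈ frontier Ω, Filter.Tendsto (fun x => Real.sqrt (∑ i, (pd u i x) ^ 2))
      (nhdsWithin z Ω) Filter.atTop)
    (heuler : ∀ x ∈ Ω, ∀ k, ∑ i, x i * pd2 u i k x = pd u k x) : Ω = Set.univ := by
  obtain ⟨x, hx⟩ := hΩne
  have hray : ∀ y ∈ Ω, ∀ t : ℝ, 0 < t → t • y ∈ Ω ∧ ∀ k, pd u k (t • y) = t * pd u k y :=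
    fun y hy t ht => pd_smul_of_euler hu hΩ hbd heuler hy ht
  have h0 : (0 : EuclideanSpace ℝ (Fin n)) ∈ Ω := by
    refine closure_subset_of_gradient_bounded hΩ hbd (S := (fun r : ℝ => r • x) '' Set.Ioo 0 1)
      (R := ∑ k, (pd u k x) ^ 2) ?_ ?_ ?_
    · rintro _ ⟨r, hr, rfl⟩
      exact (hray x hx r hr.1).1
    · rintro _ ⟨r, hr, rfl⟩
      refine Finset.sum_le_sum fun k _ => ?_
      rw [(hray x hx r hr.1).2 k, mul_pow]
      exact mul_le_of_le_one_left (sq_nonneg _) (pow_le_one₀ hr.1.le hr.2.le)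
    · refine image_closure_subset_closure_image (by fun_prop) ⟨0, ?_, zero_smul ℝ x⟩
      rw [closure_Ioo (by norm_num)]
      exact ⟨le_rfl, zero_le_one⟩
  obtain ⟨r, hr, hball⟩ := Metric.isOpen_iff.1 hΩ 0 h0
  refine Set.eq_univ_of_forall fun y => ?_
  have ht : 0 < ‖y‖ / r + 1 := by positivity
  have hy : (‖y‖ / r + 1)⁻¹ • y ∈ Ω := by
    refine hball ?_
    rw [mem_ball_zero_iff, norm_smul, norm_inv, Real.norm_of_nonneg ht.le, inv_mul_lt_iff₀ ht]
    have : (‖y‖ / r + 1) * r = ‖y‖ + r := by field_simp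
    linarith
  have := (hray _ hy _ ht).1
  rwa [smul_inv_smul₀ ht.ne'] at this

lemma sum_pd2_zero_eq_of_euler (hu : ContDiffOn ℝ ∞ u Set.univ)
    (heuler : ∀ x : EuclideanSpace ℝ (Fin n), ∀ k, ∑ i, x i * pd2 u i k x = pd u k x)
    (x : EuclideanSpace ℝ (Fin n)) (k : Fin n) : ∑ i, x i * pd2 u i k 0 = pd u k x := by
  have hray : ∀ t : ℝ, 0 < t → pd u k (t • x) = t * pd u k x := fun t ht =>
    (pd_smul_of_euler hu isOpen_univ (by simp) (fun x _ => heuler x) (Set.mem_univ x) ht).2 k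
  have hc : Continuous fun t : ℝ => ∑ i, x i * pd2 u i k (t • x) := by
    refine continuous_finsetSum _ fun i _ => continuous_const.mul ?_
    have : Continuous (pd2 u i k) :=
      continuousOn_univ.1 (hu.contDiffOn_pd2 isOpen_univ i k).continuousOn
    exact this.comp (by fun_prop)
  have h1 : Filter.Tendsto (fun t : ℝ => ∑ i, x i * pd2 u i k (t • x))
      (nhdsWithin 0 (Set.Ioi 0)) (nhds (∑ i, x i * pd2 u i k 0)) := by
    have := hc.tendsto 0
    rw [zero_smul] at this
    exact this.mono_left nhdsWithin_le_nhds
  refine tendsto_nhds_unique h1 (tendsto_const_nhds.congr' ?_)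
  filter_upwards [self_mem_nhdsWithin] with t ht
  have ht0 : (0 : ℝ) < t := ht
  have h2 := heuler (t • x) k
  rw [hray t ht0] at h2
  simp only [PiLp.smul_apply, smul_eq_mul, mul_assoc, ← Finset.mul_sum] at h2
  exact (mul_left_cancel₀ ht0.ne' h2).symm

end Rigidity

/-- Rigidity of graphical Lagrangian shrinkers with gradient blowing up at the boundary:
any smooth solution of the Lagrangian shrinker potential equation
`∑ arctan λᵢ(D²u) = (1/2) x·∇u − u` on a nonempty open connected `Ω ⊆ ℝⁿ`, with
`‖∇u‖ → ∞` at every boundary point of `Ω`, is a quadratic polynomial on `Ω = ℝⁿ`;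
i.e. the Lagrangian shrinker `(x, ∇u(x))` is a plane. -/
theorem lagrangian_shrinker_rigidity
    (n : ℕ) (hn : 1 ≤ n) (Ω : Set (EuclideanSpace ℝ (Fin n)))
    (hΩne : Ω.Nonempty) (hΩo : IsOpen Ω) (hΩc : IsConnected Ω)
    (u : EuclideanSpace ℝ (Fin n) → ℝ)
    (hu : ContDiffOn ℝ (⊤ : ℕ∞) u Ω)
    (heq : ∀ x ∈ Ω, ∀ h : (hessM u x).IsHermitian,
      ∑ i, Real.arctan (h.eigenvalues i)
        = (1 / 2) * (∑ i, x i * pd u i x) - u x)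
    (hbd : ∀ z ∈ frontier Ω,
      Filter.Tendsto (fun x => Real.sqrt (∑ i, (pd u i x) ^ 2))
        (nhdsWithin z Ω) Filter.atTop) :
    Ω = Set.univ ∧
      ∃ A : Matrix (Fin n) (Fin n) ℝ, A.IsSymm ∧ ∃ c : ℝ,
        ∀ x : EuclideanSpace ℝ (Fin n),
          u x = (1 / 2) * (∑ i, ∑ j, A i j * x i * x j) + c := by
  have heq' : SolvesShrinkerPotentialEq u Ω := heq
  obtain ⟨x₀, hx₀, hmax⟩ := heq'.exists_forall_shrinkerPhase_le hu hΩo hΩne hbd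
  have hconst := eqOn_of_shrinkerOp_nonneg hΩo hΩc.isPreconnected
    (fun x hx => posDef_inverseMetric hu hΩo hx) (continuousOn_inverseMetric hu hΩo)
    (contDiffOn_shrinkerPhase hu hΩo)
    (fun x hx => (heq'.shrinkerOp_shrinkerPhase hu hΩo hx).ge) hx₀ hmax
  have heuler : ∀ x ∈ Ω, ∀ k, ∑ i, x i * pd2 u i k x = pd u k x := by
    intro x hx k
    have h1 := pd_shrinkerPhase hu hΩo hx k
    rw [Set.EqOn.pd_eq hconst hΩo k hx, pd_const] at h1
    linarith
  have huniv : Ω = Set.univ := eq_univ_of_euler hu hΩo hΩne hbd heuler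
  subst huniv
  have hlin := sum_pd2_zero_eq_of_euler hu fun x => heuler x (Set.mem_univ x)
  refine ⟨rfl, hessM u 0, isHermitian_hessM hu hΩo (Set.mem_univ 0), -shrinkerPhase u x₀,
    fun x => ?_⟩
  have hx : (1 / 2) * (∑ i, x i * pd u i x) - u x = shrinkerPhase u x₀ :=
    hconst x (Set.mem_univ x)
  have hquad : ∑ i, ∑ j, hessM u 0 i j * x i * x j = ∑ i, x i * pd u i x := by
    rw [Finset.sum_comm]
    refine Finset.sum_congr rfl fun j _ => ?_
    rw [← hlin x j, Finset.mul_sum]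
    exact Finset.sum_congr rfl fun i _ => by
      simp only [hessM, Matrix.of_apply]
      ring
  rw [hquad]
  linarith
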